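/- arXiv:1407.2529 — 4 statements merged into one kernel-verified Lean document; each statement's English description precedes it below -/
import Mathlib

section
/- Let k be an imperfect field of characteristic p > 0 with algebraic closure Ω, let t ∈ k \ k^p, and let k_n := k(t^{1/p^n}) ⊆ Ω for n ≥ 1. If R is a Noetherian local k-algebra, then edim(R) ≤ edim(R ⊗_k k_1) ≤ edim(R ⊗_k k_2) ≤ edim(R) + 1. In particular, the embedding jump of R over any of the extensions k_n/k is 0 or 1. -/
open TensorProduct IsLocalRing IntermediateField

/-- The embedding dimension of a local ring: the dimension of the Zariski cotangent space
`m/m²` over the residue field. -/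
noncomputable def edim (R : Type) [CommRing R] [IsLocalRing R] : ℕ :=
  Module.finrank (ResidueField R) (CotangentSpace R)

lemma edim_le_card {A : Type} [CommRing A] [IsLocalRing A] [IsNoetherianRing A] (s : Set A)
    (hf : s.Finite) (hs : Ideal.span s = maximalIdeal A) : edim A ≤ s.ncard := by
  rw [edim, ← spanFinrank_maximalIdeal_eq_finrank_cotangentSpace, ← hs]
  exact Submodule.spanFinrank_span_le_ncard_of_finite hf

lemma exists_gens {B : Type} [CommRing B] [IsLocalRing B] [IsNoetherianRing B] (G : Set B)
    (hG : Ideal.span G = maximalIdeal B) :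
    ∃ s : Set B, s.Finite ∧ s ⊆ G ∧ Ideal.span s = maximalIdeal B ∧ s.ncard ≤ edim B := by
  have hsub : G ⊆ maximalIdeal B := by rw [← hG]; exact Ideal.subset_span
  let G' : Set (maximalIdeal B) := Subtype.val ⁻¹' G
  have hG' : Submodule.span B G' = ⊤ := by
    apply Submodule.map_injective_of_injective (Submodule.injective_subtype (maximalIdeal B))
    rw [Submodule.map_span, Submodule.map_top, Submodule.range_subtype]
    refine Eq.trans ?_ hG
    change Submodule.span B _ = Submodule.span B _
    congr 1
    ext x
    simp only [G', Set.mem_image, Set.mem_preimage]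
    exact ⟨by rintro ⟨x, h, rfl⟩; exact h, fun h => ⟨⟨x, hsub h⟩, h, rfl⟩⟩
  rw [← CotangentSpace.span_image_eq_top_iff] at hG'
  obtain ⟨b, hb, hspan, hli⟩ := exists_linearIndependent (ResidueField B)
    ((maximalIdeal B).toCotangent '' G')
  obtain ⟨s, hs, hsb⟩ := (Set.exists_subset_bijOn G' (maximalIdeal B).toCotangent)
  obtain ⟨t, hts, htb⟩ : ∃ t ⊆ s, Set.BijOn (maximalIdeal B).toCotangent t b := by
    refine ⟨s ∩ (maximalIdeal B).toCotangent ⁻¹' b, Set.inter_subset_left, ?_, ?_, ?_⟩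
    · intro x hx; exact hx.2
    · exact hsb.injOn.mono Set.inter_subset_left
    · intro x hx
      obtain ⟨y, hy, rfl⟩ := hsb.surjOn (hb hx)
      exact ⟨y, ⟨hy, hx⟩, rfl⟩
  have hbf : b.Finite := hli.setFinite
  have htf : t.Finite := htb.finite_iff_finite.mpr hbf
  have h1 : Submodule.span B t = ⊤ := by
    rw [← CotangentSpace.span_image_eq_top_iff, htb.image_eq, hspan, hG']
  refine ⟨Subtype.val '' t, htf.image _, ?_, ?_, ?_⟩
  · rintro _ ⟨x, hx, rfl⟩; exact hs (hts hx)
  · have := congrArg (Submodule.map (maximalIdeal B).subtype) h1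
    rwa [Submodule.map_span, Submodule.map_top, Submodule.range_subtype] at this
  · rw [Set.ncard_image_of_injective _ Subtype.val_injective, ← htb.injOn.ncard_image,
      htb.image_eq]
    have := hbf.fintype
    rw [Set.ncard_eq_toFinset_card', Set.toFinset_card]
    exact hli.fintype_card_le_finrank

lemma edim_le_of_equiv {A B : Type} [CommRing A] [IsLocalRing A] [IsNoetherianRing A]
    [CommRing B] [IsLocalRing B] (e : A ≃+* B) : edim B ≤ edim A := by
  obtain ⟨s, hf, -, hs, hc⟩ := exists_gens (B := A) (maximalIdeal A) (Ideal.span_eq _)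
  have : IsNoetherianRing B := isNoetherianRing_of_ringEquiv A e
  refine (edim_le_card (e '' s) (hf.image _) ?_).trans ((Set.ncard_image_le hf).trans hc)
  have := congrArg (Ideal.map (e : A →+* B)) hs
  rw [Ideal.map_span] at this
  refine this.trans ?_
  ext x
  change x ∈ Ideal.map e (maximalIdeal A) ↔ _
  rw [← Ideal.comap_symm, Ideal.mem_comap]
  simp

lemma edim_eq_of_equiv {A B : Type} [CommRing A] [IsLocalRing A] [IsNoetherianRing A]
    [CommRing B] [IsLocalRing B] (e : A ≃+* B) : edim B = edim A := by
  have : IsNoetherianRing B := isNoetherianRing_of_ringEquiv A e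
  exact le_antisymm (edim_le_of_equiv e) (edim_le_of_equiv e.symm)

open Polynomial in
lemma edim_upper {A B : Type} [CommRing A] [IsLocalRing A] [IsNoetherianRing A]
    [CommRing B] [IsLocalRing B] [IsNoetherianRing B] [Algebra A B] [Module.FaithfullyFlat A B]
    (y : B) (hsurj : Function.Surjective (aeval y : A[X] →ₐ[A] B)) : edim B ≤ edim A + 1 := by
  obtain ⟨s, hf, -, hs, hc⟩ := exists_gens (B := A) (maximalIdeal A) (Ideal.span_eq _)
  have hmB : (maximalIdeal A).map (algebraMap A B) ≤ maximalIdeal B := by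
    apply IsLocalRing.le_maximalIdeal
    intro h
    have := Ideal.comap_map_eq_self_of_faithfullyFlat (B := B) (maximalIdeal A)
    rw [h, Ideal.comap_top] at this
    exact (maximalIdeal.isMaximal A).ne_top this.symm
  let N := (maximalIdeal B).comap (aeval y : A[X] →ₐ[A] B)
  let q : A[X] →+* (ResidueField A)[X] := mapRingHom (residue A)
  have hq : Function.Surjective q := map_surjective _ (residue_surjective)
  have hker : ∀ f : A[X], q f = 0 → aeval y f ∈ (maximalIdeal A).map (algebraMap A B) := by
    intro f hfz
    rw [aeval_eq_sum_range]
    refine Ideal.sum_mem _ fun i _ => ?_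
    rw [Algebra.smul_def]
    refine Ideal.mul_mem_right _ _ (Ideal.mem_map_of_mem _ ?_)
    have := congrArg (fun g => coeff g i) hfz
    simpa [q] using this
  obtain ⟨g', hg'⟩ := (IsPrincipalIdealRing.principal (N.map q)).principal
  have hg'm : g' ∈ N.map q := by rw [hg']; exact Submodule.mem_span_singleton_self _
  obtain ⟨g, hgN, rfl⟩ := (Ideal.mem_map_iff_of_surjective q hq).1 hg'm
  refine (edim_le_card (insert (aeval y g) (algebraMap A B '' s)) ((hf.image _).insert _) ?_).trans
    ((Set.ncard_insert_le _ _).trans (Nat.add_le_add_right ((Set.ncard_image_le hf).trans hc) 1))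
  rw [Ideal.span_insert, ← Ideal.map_span, hs]
  refine le_antisymm (sup_le ?_ hmB) ?_
  · rw [Ideal.span_singleton_le_iff_mem]; exact hgN
  · intro b hb
    obtain ⟨f, rfl⟩ := hsurj b
    have h1 : q f ∈ N.map q := Ideal.mem_map_of_mem _ hb
    rw [hg'] at h1
    obtain ⟨a, ha⟩ := Ideal.mem_span_singleton'.1 h1
    obtain ⟨a, rfl⟩ := hq a
    have h2 := hker (f - a * g) (by rw [map_sub, map_mul, ha, sub_self])
    have : aeval y f = aeval y a * aeval y g + aeval y (f - a * g) := by simp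
    rw [this]
    exact Ideal.add_mem _ (Ideal.mem_sup_left (Ideal.mul_mem_left _ _
      (Ideal.mem_span_singleton_self _))) (Ideal.mem_sup_right h2)

open Polynomial in
lemma edim_lower_core (p : ℕ) [Fact p.Prime] {A B : Type} [CommRing A] [IsLocalRing A]
    [IsNoetherianRing A]
    [CommRing B] [IsLocalRing B] [IsNoetherianRing B] [Algebra A B] [Module.FaithfullyFlat A B]
    [CharP B p]
    (y : B) (u : A) (hy : y ^ p = algebraMap A B u)
    (hsurj : Function.Surjective (aeval y : A[X] →ₐ[A] B))
    (hlift : ∀ (I : Ideal A) (c : A), c ^ p - u ∈ I →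
      ∃ φ : B →ₐ[A] A ⧸ I, φ y = Ideal.Quotient.mk I c) :
    edim A ≤ edim B := by
  have hp : p.Prime := Fact.out
  have hmB : (maximalIdeal A).map (algebraMap A B) ≤ maximalIdeal B := by
    apply IsLocalRing.le_maximalIdeal
    intro h
    have := Ideal.comap_map_eq_self_of_faithfullyFlat (B := B) (maximalIdeal A)
    rw [h, Ideal.comap_top] at this
    exact (maximalIdeal.isMaximal A).ne_top this.symm
  have hcomap : (maximalIdeal B).comap (algebraMap A B) ≤ maximalIdeal A := by
    apply IsLocalRing.le_maximalIdeal
    rw [Ne, Ideal.comap_eq_top_iff]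
    exact (maximalIdeal.isMaximal B).ne_top
  -- generators coming from `A`
  have caseA : ∀ s : Set A, s.Finite →
      Ideal.span (algebraMap A B '' s) = maximalIdeal B → Ideal.span s = maximalIdeal A := by
    intro s hf hs
    rw [← Ideal.map_span] at hs
    rw [← Ideal.comap_map_eq_self_of_faithfullyFlat (B := B) (Ideal.span s), hs]
    exact le_antisymm hcomap (Ideal.map_le_iff_le_comap.1 hmB)
  have pull : ∀ T : Set B, T.Finite → T ⊆ algebraMap A B '' (maximalIdeal A) →
      ∃ s : Set A, s.Finite ∧ algebraMap A B '' s = T ∧ s.ncard = T.ncard := by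
    intro T hT hTs
    obtain ⟨s, -, hs⟩ := Set.SurjOn.exists_bijOn_subset hTs
    exact ⟨s, hs.finite_iff_finite.mpr hT, hs.image_eq, by
      rw [← hs.image_eq, hs.injOn.ncard_image]⟩
  by_cases hc : ∃ c : A, c ^ p - u ∈ maximalIdeal A
  · obtain ⟨c, hc⟩ := hc
    set g : B := y - algebraMap A B c with hg
    have hgp : g ^ p = algebraMap A B (u - c ^ p) := by
      rw [hg, sub_pow_char, hy, map_sub, map_pow]
    have hum : u - c ^ p ∈ maximalIdeal A := by
      rw [← neg_sub]; exact neg_mem hc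
    have hgn : g ∈ maximalIdeal B := by
      refine (maximalIdeal.isMaximal B).isPrime.mem_of_pow_mem p ?_
      rw [hgp]
      exact hmB (Ideal.mem_map_of_mem _ hum)
    have hG : Ideal.span (insert g (algebraMap A B '' (maximalIdeal A))) = maximalIdeal B := by
      rw [Ideal.span_insert]
      change _ ⊔ (maximalIdeal A).map (algebraMap A B) = _
      refine le_antisymm (sup_le ?_ hmB) ?_
      · rw [Ideal.span_singleton_le_iff_mem]; exact hgn
      · intro b hb
        obtain ⟨f, rfl⟩ := hsurj b
        obtain ⟨h, hh⟩ := X_sub_C_dvd_sub_C_eval (a := c) (p := f)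
        have h1 : f = (X - C c) * h + C (f.eval c) := by rw [← hh]; ring
        have h2 : aeval y f = g * aeval y h + algebraMap A B (f.eval c) := by
          conv_lhs => rw [h1]
          simp [hg]
        have h3 : algebraMap A B (f.eval c) ∈ maximalIdeal B := by
          have : algebraMap A B (f.eval c) = aeval y f - g * aeval y h := by rw [h2]; ring
          rw [this]
          exact sub_mem hb (Ideal.mul_mem_right _ _ hgn)
        rw [h2]
        exact Ideal.add_mem _ (Ideal.mem_sup_left (Ideal.mul_mem_right _ _
          (Ideal.mem_span_singleton_self _)))
          (Ideal.mem_sup_right (Ideal.mem_map_of_mem _ (hcomap h3)))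
    obtain ⟨T, hTf, hTG, hT, hcard⟩ := exists_gens _ hG
    by_cases hgT : g ∈ T
    · obtain ⟨s, hsf, hsT, hsc⟩ := pull ((T \ {g}) ∩ algebraMap A B '' (maximalIdeal A))
        (hTf.subset (fun x hx => hx.1.1)) Set.inter_subset_right
      have hTeq : T \ {g} ∩ algebraMap A B '' (maximalIdeal A) = T \ {g} := by
        apply Set.inter_eq_left.2
        rintro x ⟨hx, hxg⟩
        exact (hTG hx).resolve_left hxg
      rw [hTeq] at hsT hsc
      refine (edim_le_card (insert (c ^ p - u) s) (hsf.insert _) ?_).trans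
        ((Set.ncard_insert_le _ _).trans ?_)
      swap
      · rw [hsc, Set.ncard_sdiff_singleton_add_one hgT hTf]; exact hcard
      set I := Ideal.span (insert (c ^ p - u) s) with hI
      obtain ⟨φ, hφ⟩ := hlift I c (Ideal.subset_span (Set.mem_insert _ _))
      apply le_antisymm
      · rw [hI, Ideal.span_le]
        rintro x (rfl | hx)
        · exact hc
        · apply hcomap
          rw [Ideal.mem_comap, ← hT]
          apply Ideal.subset_span
          have : algebraMap A B x ∈ T \ {g} := by rw [← hsT]; exact ⟨x, hx, rfl⟩
          exact this.1
      · intro a ha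
        have h1 : maximalIdeal B ≤ RingHom.ker φ := by
          rw [← hT, Ideal.span_le]
          intro x hx
          rw [SetLike.mem_coe, RingHom.mem_ker]
          by_cases hxg : x = g
          · rw [hxg, hg, map_sub, hφ, AlgHom.commutes]
            simp
          · have : x ∈ algebraMap A B '' s := by rw [hsT]; exact ⟨hx, hxg⟩
            obtain ⟨z, hz, rfl⟩ := this
            rw [AlgHom.commutes]
            exact Ideal.Quotient.eq_zero_iff_mem.2 (Ideal.subset_span (Set.mem_insert_of_mem _ hz))
        have h2 := h1 (hmB (Ideal.mem_map_of_mem _ ha))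
        rw [RingHom.mem_ker, AlgHom.commutes] at h2
        exact Ideal.Quotient.eq_zero_iff_mem.1 h2
    · obtain ⟨s, hsf, hsT, hsc⟩ := pull T hTf
        (fun x hx => (hTG hx).resolve_left (fun h => hgT (h ▸ hx)))
      exact (edim_le_card s hsf (caseA s hsf (by rw [hsT, hT]))).trans (hsc.trans_le hcard)
  · have hG : Ideal.span (algebraMap A B '' (maximalIdeal A)) = maximalIdeal B := by
      change (maximalIdeal A).map (algebraMap A B) = _
      refine le_antisymm hmB ?_
      let q : A[X] →+* (ResidueField A)[X] := mapRingHom (residue A)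
      have hq : Function.Surjective q := map_surjective _ (residue_surjective)
      have hker : ∀ f : A[X], q f = 0 → aeval y f ∈ (maximalIdeal A).map (algebraMap A B) := by
        intro f hfz
        rw [aeval_eq_sum_range]
        refine Ideal.sum_mem _ fun i _ => ?_
        rw [Algebra.smul_def]
        refine Ideal.mul_mem_right _ _ (Ideal.mem_map_of_mem _ ?_)
        have := congrArg (fun g => coeff g i) hfz
        simpa [q] using this
      have hirr : Irreducible (X ^ p - C (residue A u)) := by
        apply X_pow_sub_C_irreducible_of_prime hp
        intro b hb
        obtain ⟨b, rfl⟩ := residue_surjective b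
        apply hc
        refine ⟨b, ?_⟩
        rw [← residue_eq_zero_iff, map_sub, map_pow, hb, sub_self]
      have hqP : q (X ^ p - C u) = X ^ p - C (residue A u) := by simp [q]
      have haP : aeval y (X ^ p - C u) = 0 := by simp [hy]
      intro b hb
      obtain ⟨f, rfl⟩ := hsurj b
      by_cases hd : (X ^ p - C (residue A u)) ∣ q f
      · obtain ⟨l, hl⟩ := hd
        obtain ⟨l, rfl⟩ := hq l
        have := hker (f - (X ^ p - C u) * l) (by rw [map_sub, map_mul, hqP, hl, sub_self])
        rwa [map_sub, map_mul, haP, zero_mul, sub_zero] at this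
      · exfalso
        obtain ⟨a, b, hab⟩ := (hirr.coprime_iff_not_dvd).2 hd
        obtain ⟨a, rfl⟩ := hq a
        obtain ⟨b, rfl⟩ := hq b
        have := hmB (hker (a * (X ^ p - C u) + b * f - 1) (by
          rw [map_sub, map_add, map_mul, map_mul, hqP, hab, map_one, sub_self]))
        rw [map_sub, map_add, map_mul, map_mul, haP, mul_zero, zero_add, map_one] at this
        have h1 : (1 : B) ∈ maximalIdeal B := by
          have := sub_mem (Ideal.mul_mem_left _ (aeval y b) hb) this
          simpa using this
        exact (Ideal.ne_top_iff_one _).1 (maximalIdeal.isMaximal B).ne_top h1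
    obtain ⟨T, hTf, hTG, hT, hcard⟩ := exists_gens _ hG
    obtain ⟨s, hsf, hsT, hsc⟩ := pull T hTf hTG
    exact (edim_le_card s hsf (caseA s hsf (by rw [hsT, hT]))).trans (hsc.trans_le hcard)

section
open Polynomial

lemma surj_aeval_tensor {F E : Type} [Field F] [Field E] [Algebra F E] (x : E)
    (htop : Algebra.adjoin F {x} = ⊤) (A : Type) [CommRing A] [Algebra F A] :
    Function.Surjective (aeval (1 ⊗ₜ x : A ⊗[F] E) : A[X] →ₐ[A] A ⊗[F] E) := by
  rw [← AlgHom.range_eq_top, eq_top_iff]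
  rintro b -
  induction b using TensorProduct.induction_on with
  | zero => exact zero_mem _
  | add a b ha hb => exact add_mem ha hb
  | tmul a e =>
    have : e ∈ Algebra.adjoin F {x} := by rw [htop]; trivial
    rw [Algebra.adjoin_singleton_eq_range_aeval] at this
    obtain ⟨f, rfl⟩ := this
    refine ⟨C a * f.map (algebraMap F A), ?_⟩
    have : (1 ⊗ₜ x : A ⊗[F] E) = Algebra.TensorProduct.includeRight x := rfl
    change aeval (1 ⊗ₜ x : A ⊗[F] E) (C a * _) = a ⊗ₜ aeval x f
    rw [map_mul, aeval_map_algebraMap, aeval_C, this, aeval_algHom_apply]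
    simp

lemma edim_tensor_upper {F E : Type} [Field F] [Field E] [Algebra F E] [FiniteDimensional F E]
    (x : E) (htop : Algebra.adjoin F {x} = ⊤) (A : Type) [CommRing A] [IsLocalRing A]
    [IsNoetherianRing A] [Algebra F A] [IsLocalRing (A ⊗[F] E)] :
    edim (A ⊗[F] E) ≤ edim A + 1 := by
  have : IsNoetherianRing (A ⊗[F] E) := IsNoetherianRing.of_finite A _
  exact edim_upper _ (surj_aeval_tensor x htop A)

lemma edim_tensor_step (p : ℕ) [Fact p.Prime] {F E : Type} [Field F] [Field E] [Algebra F E]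
    [FiniteDimensional F E] [CharP F p]
    (x : E) (u : F) (hx : x ^ p = algebraMap F E u)
    (htop : Algebra.adjoin F {x} = ⊤) (A : Type) [CommRing A] [IsLocalRing A]
    [IsNoetherianRing A] [Algebra F A] [IsLocalRing (A ⊗[F] E)] :
    edim A ≤ edim (A ⊗[F] E) := by
  have : IsNoetherianRing (A ⊗[F] E) := IsNoetherianRing.of_finite A _
  have : CharP E p := charP_of_injective_algebraMap (algebraMap F E).injective p
  by_cases hu : ∃ c : F, c ^ p = u
  · obtain ⟨c, rfl⟩ := hu
    have hxc : x = algebraMap F E c := by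
      apply frobenius_inj E p
      simp [frobenius_def, hx]
    have hsurj : Function.Surjective (algebraMap F E) := by
      intro e
      have : e ∈ Algebra.adjoin F {x} := by rw [htop]; trivial
      rw [Algebra.adjoin_singleton_eq_range_aeval] at this
      obtain ⟨f, rfl⟩ := this
      exact ⟨f.eval c, by rw [hxc]; simp [aeval_algebraMap_apply]⟩
    let e : F ≃ₐ[F] E := AlgEquiv.ofBijective (Algebra.ofId F E) ⟨(algebraMap F E).injective, hsurj⟩
    let e' : A ≃ₐ[F] A ⊗[F] E := (Algebra.TensorProduct.rid F F A).symm.trans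
      (Algebra.TensorProduct.congr AlgEquiv.refl e)
    exact (edim_eq_of_equiv e'.toRingEquiv).ge
  · push Not at hu
    have hirr : Irreducible (X ^ p - C u) := X_pow_sub_C_irreducible_of_prime Fact.out hu
    have hint : IsIntegral F x := IsIntegral.of_finite F x
    have hmin : minpoly F x = X ^ p - C u := by
      symm
      apply minpoly.eq_of_irreducible_of_monic hirr
      · simp [hx]
      · exact monic_X_pow_sub_C _ (Fact.out : p.Prime).ne_zero
    let pb := PowerBasis.ofAdjoinEqTop hint htop
    have hpb : pb.gen = x := by simp [pb]
    have : CharP (A ⊗[F] E) p :=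
      charP_of_injective_algebraMap (algebraMap F (A ⊗[F] E)).injective p
    refine edim_lower_core p (1 ⊗ₜ x : A ⊗[F] E) (algebraMap F A u) ?_ (surj_aeval_tensor x htop A) ?_
    · rw [Algebra.TensorProduct.tmul_pow, hx, one_pow, ← IsScalarTower.algebraMap_apply,
        Algebra.TensorProduct.algebraMap_apply, Algebra.algebraMap_eq_smul_one,
        Algebra.algebraMap_eq_smul_one, TensorProduct.smul_tmul]
    · intro I c hc
      let ψ : E →ₐ[F] A ⧸ I := pb.lift (Ideal.Quotient.mk I c) (by
        rw [hpb, hmin]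
        have := Ideal.Quotient.eq_zero_iff_mem.2 hc
        simpa using this)
      refine ⟨Algebra.TensorProduct.lift (Algebra.ofId A _) ψ (fun _ _ => Commute.all _ _), ?_⟩
      have : ψ x = Ideal.Quotient.mk I c := by
        conv_lhs => rw [← hpb]
        exact pb.lift_gen _ _
      simp [this]
end

lemma isLocalRing_tensor_descend {F E : Type} [Field F] [Field E] [Algebra F E]
    (A : Type) [CommRing A] [Algebra F A] [IsLocalRing (A ⊗[F] E)] : IsLocalRing A :=
  RingHom.domain_isLocalRing (algebraMap A (A ⊗[F] E))

lemma isNoeth_tensor {k : Type} (E : Type) [Field k] [Field E] [Algebra k E]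
    [FiniteDimensional k E] (R : Type) [CommRing R] [IsNoetherianRing R] [Algebra k R] :
    IsNoetherianRing (R ⊗[k] E) := IsNoetherianRing.of_finite R _

lemma edim_tower_step (p : ℕ) [Fact p.Prime] {k E : Type} [Field k] [Field E] [Algebra k E]
    [FiniteDimensional k E] [CharP k p] (F : Type) [Field F] [Algebra k F] [Algebra F E]
    [IsScalarTower k F E] [FiniteDimensional k F] [FiniteDimensional F E]
    (x : E) (u : F) (hx : x ^ p = algebraMap F E u)
    (htop : Algebra.adjoin k {x} = ⊤) (R : Type) [CommRing R]
    [IsNoetherianRing R] [Algebra k R] [IsLocalRing (R ⊗[k] E)] :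
    ∃ _ : IsLocalRing (R ⊗[k] F), edim (R ⊗[k] F) ≤ edim (R ⊗[k] E) := by
  have : IsNoetherianRing (R ⊗[k] F) := isNoeth_tensor F R
  have : IsNoetherianRing (R ⊗[k] E) := IsNoetherianRing.of_finite R _
  have : CharP F p := charP_of_injective_algebraMap (algebraMap k F).injective p
  let e₁ : R ⊗[k] F ≃+* F ⊗[k] R := (Algebra.TensorProduct.comm k R F).toRingEquiv
  let e₂ : R ⊗[k] E ≃+* (F ⊗[k] R) ⊗[F] E :=
    ((Algebra.TensorProduct.comm k R E).toRingEquiv.trans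
      (Algebra.TensorProduct.cancelBaseChange k F F E R).symm.toRingEquiv).trans
      (Algebra.TensorProduct.comm F E (F ⊗[k] R)).toRingEquiv
  have : IsNoetherianRing (F ⊗[k] R) := isNoetherianRing_of_ringEquiv _ e₁
  have : IsLocalRing ((F ⊗[k] R) ⊗[F] E) := e₂.isLocalRing
  have : IsLocalRing (F ⊗[k] R) := isLocalRing_tensor_descend (F := F) (E := E) _
  have hloc : IsLocalRing (R ⊗[k] F) := e₁.symm.isLocalRing
  have htop' : Algebra.adjoin F {x} = ⊤ := by
    rw [eq_top_iff]
    rintro y -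
    have hy : y ∈ Algebra.adjoin k {x} := by rw [htop]; trivial
    have := Algebra.adjoin_le (S := (Algebra.adjoin F {x}).restrictScalars k)
      (R := k) (s := {x}) Algebra.subset_adjoin
    exact this hy
  refine ⟨hloc, ?_⟩
  rw [← edim_eq_of_equiv e₁, ← edim_eq_of_equiv e₂]
  exact edim_tensor_step p x u hx htop' _

lemma adjoin_gen_top {k Ω : Type} [Field k] [Field Ω] [Algebra k Ω] (x : Ω)
    (hx : IsIntegral k x) :
    Algebra.adjoin k {AdjoinSimple.gen k x} = ⊤ := by
  have := (adjoin.powerBasis hx).adjoin_gen_eq_top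
  rwa [adjoin.powerBasis_gen] at this

lemma edim_tensor_lower (p : ℕ) [Fact p.Prime] {k : Type} [Field k] [CharP k p]
    (R : Type) [CommRing R] [IsLocalRing R] [IsNoetherianRing R] [Algebra k R] (n : ℕ) :
    ∀ {E : Type} [Field E] [Algebra k E] [FiniteDimensional k E]
    (x : E) (t : k) (_ : x ^ p ^ n = algebraMap k E t) (_ : Algebra.adjoin k {x} = ⊤)
    [IsLocalRing (R ⊗[k] E)], edim R ≤ edim (R ⊗[k] E) := by
  induction n with
  | zero =>
    intro E _ _ _ x t hx htop _
    refine edim_tensor_step p x (t ^ p) ?_ htop R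
    rw [map_pow, ← hx]; simp
  | succ n ih =>
    intro E _ _ _ x t hx htop _
    obtain ⟨h, hle⟩ := edim_tower_step p (adjoin k {x ^ p} : IntermediateField k E) x
      (AdjoinSimple.gen k (x ^ p)) rfl htop R
    refine (ih (AdjoinSimple.gen k (x ^ p)) t ?_ (adjoin_gen_top _ (IsIntegral.of_finite k _))).trans
      hle
    apply Subtype.ext
    change (x ^ p) ^ p ^ n = algebraMap k E t
    rw [← hx, ← pow_mul, pow_succ']

/-- Let `k` be an imperfect field of characteristic `p` with algebraic
closure `Ω`, `t ∈ k \ kᵖ`, and `kₙ := k(t^{1/pⁿ}) ⊆ Ω`.  For any Noetherian local `k`-algebra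
`R`, `edim R ≤ edim (R ⊗_k k₁) ≤ edim (R ⊗_k k₂) ≤ edim R + 1`; in particular the embedding
jump of `R` over any of the extensions `kₙ/k` is `0` or `1`. -/
theorem edim_tensor_adjoin_root_chain
    (p : ℕ) [Fact p.Prime]
    (k Ω : Type) [Field k] [Field Ω] [CharP k p] [Algebra k Ω] [IsAlgClosure k Ω]
    (t : k) (ht : ∀ c : k, c ^ p ≠ t)
    (R : Type) [CommRing R] [IsLocalRing R] [IsNoetherianRing R] [Algebra k R]
    (x₁ x₂ : Ω) (hx₁ : x₁ ^ p = algebraMap k Ω t) (hx₂ : x₂ ^ p ^ 2 = algebraMap k Ω t)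
    [IsLocalRing (R ⊗[k] (adjoin k {x₁} : IntermediateField k Ω))]
    [IsLocalRing (R ⊗[k] (adjoin k {x₂} : IntermediateField k Ω))] :
    (edim R ≤ edim (R ⊗[k] (adjoin k {x₁} : IntermediateField k Ω)) ∧
      edim (R ⊗[k] (adjoin k {x₁} : IntermediateField k Ω)) ≤
        edim (R ⊗[k] (adjoin k {x₂} : IntermediateField k Ω)) ∧
      edim (R ⊗[k] (adjoin k {x₂} : IntermediateField k Ω)) ≤ edim R + 1) ∧
    (∀ (n : ℕ), 1 ≤ n → ∀ (xₙ : Ω), xₙ ^ p ^ n = algebraMap k Ω t →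
      ∀ [IsLocalRing (R ⊗[k] (adjoin k {xₙ} : IntermediateField k Ω))],
        edim R ≤ edim (R ⊗[k] (adjoin k {xₙ} : IntermediateField k Ω)) ∧
          edim (R ⊗[k] (adjoin k {xₙ} : IntermediateField k Ω)) ≤ edim R + 1) := by
  have hp : p.Prime := Fact.out
  have hchar : CharP Ω p := charP_of_injective_algebraMap (algebraMap k Ω).injective p
  have key : ∀ (n : ℕ) (x : Ω), x ^ p ^ n = algebraMap k Ω t →
      ∀ [IsLocalRing (R ⊗[k] (adjoin k {x} : IntermediateField k Ω))],
        edim R ≤ edim (R ⊗[k] (adjoin k {x} : IntermediateField k Ω)) ∧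
          edim (R ⊗[k] (adjoin k {x} : IntermediateField k Ω)) ≤ edim R + 1 := by
    intro n x hx _
    have hint : IsIntegral k x := IsIntegral.of_pow (n := p ^ n) (pow_pos hp.pos n)
      (hx ▸ isIntegral_algebraMap)
    have : FiniteDimensional k (adjoin k {x}) := adjoin.finiteDimensional hint
    refine ⟨edim_tensor_lower p R n (AdjoinSimple.gen k x) t ?_ (adjoin_gen_top x hint),
      edim_tensor_upper _ (adjoin_gen_top x hint) R⟩
    apply Subtype.ext
    exact hx
  refine ⟨⟨(key 1 x₁ (by rwa [pow_one])).1, ?_, (key 2 x₂ hx₂).2⟩, fun n _ x hx => key n x hx⟩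
  have hint : IsIntegral k x₂ := IsIntegral.of_pow (n := p ^ 2) (pow_pos hp.pos 2)
    (hx₂ ▸ isIntegral_algebraMap)
  have : FiniteDimensional k (adjoin k {x₂}) := adjoin.finiteDimensional hint
  have hx : x₂ ^ p = x₁ := by
    apply frobenius_inj Ω p
    rw [frobenius_def, frobenius_def, hx₁, ← hx₂, ← pow_mul, pow_two]
  let F : IntermediateField k (adjoin k {x₂}) := adjoin k {AdjoinSimple.gen k x₂ ^ p}
  obtain ⟨h, hle⟩ := edim_tower_step p F (AdjoinSimple.gen k x₂)
    (AdjoinSimple.gen k _) rfl (adjoin_gen_top x₂ hint) R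
  have hF : IntermediateField.lift F = adjoin k {x₁} := by
    simp only [F, lift_adjoin_simple]
    congr 2
  let e : F ≃ₐ[k] (adjoin k {x₁} : IntermediateField k Ω) :=
    (liftAlgEquiv F).trans (equivOfEq hF)
  have : IsNoetherianRing (R ⊗[k] F) := isNoeth_tensor F R
  rw [edim_eq_of_equiv (Algebra.TensorProduct.congr (AlgEquiv.refl (R := k) (A₁ := R)) e).toRingEquiv]
  exact hle
end

section
/- Let K/k be a finitely generated field extension of fields of characteristic p > 0, let Ω be an algebraic closure of K, and set k^{1/p} := {x ∈ Ω : x^p ∈ k}. Then the Artin local ring K ⊗_k k^{1/p} satisfies edim(K ⊗_k k^{1/p}) + trdeg(K/k) = pdeg(K/k). Moreover, for every intermediate field k' with k^{1/p} ⊆ k' ⊆ Ω and k'/k purely inseparable, edim(K ⊗_k k') = edim(K ⊗_k k^{1/p}). -/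
open TensorProduct IsLocalRing

section PartA
open TensorProduct IsLocalRing

structure HasIdx {F V W : Type} [Field F] [AddCommGroup V] [Module F V] [AddCommGroup W]
    [Module F W] (f : V →ₗ[F] W) (n : ℤ) : Prop where
  fin_ker : Module.Finite F (LinearMap.ker f)
  fin_coker : Module.Finite F (W ⧸ LinearMap.range f)
  eq : (Module.finrank F (W ⧸ LinearMap.range f) : ℤ) - Module.finrank F (LinearMap.ker f) = n

namespace HasIdx

variable {F V W U : Type} [Field F] [AddCommGroup V] [Module F V] [AddCommGroup W]
    [Module F W] [AddCommGroup U] [Module F U]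

theorem of_exact {A B : Type} [AddCommGroup A] [Module F A] [AddCommGroup B] [Module F B]
    [Module.Finite F A] [Module.Finite F B]
    (i : A →ₗ[F] V) (f : V →ₗ[F] W) (q : W →ₗ[F] B) (hi : Function.Injective i)
    (h1 : Function.Exact i f) (h2 : Function.Exact f q) (hq : Function.Surjective q) :
    HasIdx f ((Module.finrank F B : ℤ) - Module.finrank F A) := by
  have e1 : A ≃ₗ[F] LinearMap.ker f :=
    (LinearEquiv.ofInjective i hi).trans (LinearEquiv.ofEq _ _ h1.linearMap_ker_eq.symm)
  have e2 : (W ⧸ LinearMap.range f) ≃ₗ[F] B :=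
    (Submodule.quotEquivOfEq _ _ h2.linearMap_ker_eq.symm).trans
      (q.quotKerEquivOfSurjective hq)
  exact ⟨Module.Finite.equiv e1, Module.Finite.equiv e2.symm, by
    rw [e1.finrank_eq, e2.finrank_eq]⟩

theorem of_bijective {f : V →ₗ[F] W} (h : Function.Bijective f) : HasIdx f 0 := by
  have := of_exact (A := PUnit) (B := PUnit) (0 : PUnit →ₗ[F] V) f (0 : W →ₗ[F] PUnit)
    (fun _ _ _ => rfl) (by
      intro x; constructor
      · intro hx; exact ⟨0, by simpa using (h.1 (hx.trans f.map_zero.symm)).symm⟩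
      · rintro ⟨y, rfl⟩; simp) (by
      intro x; simpa using h.2 x) (fun _ => ⟨0, rfl⟩)
  simpa using this

theorem unique {f : V →ₗ[F] W} {m n : ℤ} (h : HasIdx f m) (h' : HasIdx f n) : m = n :=
  h.eq.symm.trans h'.eq

theorem comp {f : V →ₗ[F] W} {g : W →ₗ[F] U} {m n : ℤ} (hg : HasIdx g n) (hf : HasIdx f m) :
    HasIdx (g ∘ₗ f) (m + n) := by
  obtain ⟨a1, a2, a3⟩ := hf
  obtain ⟨b1, b2, b3⟩ := hg
  set M := LinearMap.range f
  set N := LinearMap.ker g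
  -- kernel
  let φ : LinearMap.ker (g ∘ₗ f) →ₗ[F] N := f.restrict (by intro x hx; exact hx)
  have hφk : LinearMap.ker f ≃ₗ[F] LinearMap.ker φ :=
    { toFun := fun x => ⟨⟨x.1, by simp [x.2]⟩, by ext; exact x.2⟩
      invFun := fun x => ⟨x.1.1, congrArg Subtype.val x.2⟩
      map_add' := fun _ _ => rfl
      map_smul' := fun _ _ => rfl
      left_inv := fun _ => rfl
      right_inv := fun _ => rfl }
  have : Module.Finite F (LinearMap.ker φ) := Module.Finite.equiv hφk
  have : Module.Finite F (LinearMap.range φ) := inferInstance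
  have fk : Module.Finite F (LinearMap.ker (g ∘ₗ f)) := by
    have : Module.Finite F ((LinearMap.ker (g ∘ₗ f)) ⧸ LinearMap.ker φ) :=
      Module.Finite.equiv φ.quotKerEquivRange.symm
    exact Module.Finite.of_submodule_quotient (LinearMap.ker φ)
  have r1 := φ.finrank_range_add_finrank_ker
  rw [← hφk.finrank_eq] at r1
  -- N → W/M
  let ψ : N →ₗ[F] (W ⧸ M) := M.mkQ ∘ₗ N.subtype
  have hψ : LinearMap.range φ = LinearMap.ker ψ := by
    ext ⟨x, hx⟩
    simp only [LinearMap.mem_range, LinearMap.mem_ker, ψ, LinearMap.comp_apply,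
      Submodule.subtype_apply, Submodule.mkQ_apply, Submodule.Quotient.mk_eq_zero]
    constructor
    · rintro ⟨y, hy⟩; exact ⟨y.1, congrArg Subtype.val hy⟩
    · rintro ⟨y, hy⟩
      refine ⟨⟨y, ?_⟩, Subtype.ext hy⟩
      rw [LinearMap.mem_ker, LinearMap.comp_apply, hy]; exact hx
  have r2 := ψ.finrank_range_add_finrank_ker
  rw [← hψ] at r2
  -- W/M → U/range gf
  let χ : (W ⧸ M) →ₗ[F] (U ⧸ LinearMap.range (g ∘ₗ f)) :=
    M.mapQ _ g (by rintro _ ⟨y, rfl⟩; exact ⟨y, rfl⟩)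
  have hχ : LinearMap.range ψ = LinearMap.ker χ := by
    ext x
    obtain ⟨x, rfl⟩ := M.mkQ_surjective x
    simp only [LinearMap.mem_range, LinearMap.mem_ker, ψ, χ, LinearMap.comp_apply,
      Submodule.subtype_apply, Submodule.mkQ_apply, Submodule.mapQ_apply,
      Submodule.Quotient.mk_eq_zero, Submodule.Quotient.eq]
    constructor
    · rintro ⟨⟨y, hy⟩, z, hz⟩
      refine ⟨-z, ?_⟩
      have : g y = 0 := hy
      simp only [map_neg, hz, map_sub, this]; simp
    · rintro ⟨z, hz⟩
      exact ⟨⟨x - f z, by simp [N, hz]⟩, ⟨-z, by simp⟩⟩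
  have r3 := χ.finrank_range_add_finrank_ker
  rw [← hχ] at r3
  let ω : (U ⧸ LinearMap.range (g ∘ₗ f)) →ₗ[F] (U ⧸ LinearMap.range g) :=
    Submodule.factor (by rintro _ ⟨y, rfl⟩; exact ⟨f y, rfl⟩)
  have hω : LinearMap.range χ = LinearMap.ker ω := by
    ext x
    obtain ⟨x, rfl⟩ := Submodule.mkQ_surjective _ x
    simp only [LinearMap.mem_range, LinearMap.mem_ker]
    constructor
    · rintro ⟨y, hy⟩
      obtain ⟨y, rfl⟩ := Submodule.mkQ_surjective _ y
      rw [← hy]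
      simp [ω, χ]
    · intro h
      have : x ∈ LinearMap.range g := by simpa [ω] using h
      obtain ⟨y, rfl⟩ := this
      exact ⟨M.mkQ y, by simp [χ]⟩
  have hωs : Function.Surjective ω := Submodule.factor_surjective _
  have fc : Module.Finite F (U ⧸ LinearMap.range (g ∘ₗ f)) := by
    have : Module.Finite F (LinearMap.ker ω) := by rw [← hω]; infer_instance
    have : Module.Finite F ((U ⧸ LinearMap.range (g ∘ₗ f)) ⧸ LinearMap.ker ω) :=
      Module.Finite.equiv (ω.quotKerEquivOfSurjective hωs).symm
    exact Module.Finite.of_submodule_quotient (LinearMap.ker ω)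
  have r4 := ω.finrank_range_add_finrank_ker
  rw [← hω, LinearMap.range_eq_top.mpr hωs, finrank_top] at r4
  exact ⟨fk, fc, by omega⟩

theorem comp_equiv {V' : Type} [AddCommGroup V'] [Module F V'] {f : V →ₗ[F] W} {n : ℤ}
    (e : V' ≃ₗ[F] V) (h : HasIdx (f ∘ₗ e.toLinearMap) n) : HasIdx f n := by
  have := h.comp (of_bijective (f := e.symm.toLinearMap) e.symm.bijective)
  rw [zero_add] at this
  convert this using 1
  ext; simp

theorem baseChange {E : Type} [Field E] [Algebra F E] {f : V →ₗ[F] W} {n : ℤ} (h : HasIdx f n) :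
    HasIdx (f.baseChange E) n := by
  obtain ⟨a1, a2, a3⟩ := h
  have := of_exact (F := E) ((LinearMap.ker f).subtype.baseChange E) (f.baseChange E)
    ((LinearMap.range f).mkQ.baseChange E)
    (Module.Flat.lTensor_preserves_injective_linearMap _ Subtype.val_injective)
    (Module.Flat.lTensor_exact E (LinearMap.exact_subtype_ker_map f))
    (Module.Flat.lTensor_exact E (LinearMap.exact_map_mkQ_range f))
    (LinearMap.lTensor_surjective _ (Submodule.mkQ_surjective _))
  rw [Module.finrank_baseChange, Module.finrank_baseChange, a3] at this
  exact this

end HasIdx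

end PartA

section PartB
open TensorProduct IsLocalRing KaehlerDifferential

section
variable (k0 A B C : Type) [CommRing k0] [CommRing A] [CommRing B] [CommRing C]
  [Algebra k0 A] [Algebra k0 B] [Algebra k0 C] [Algebra A B] [Algebra A C] [Algebra B C]
  [IsScalarTower k0 A B] [IsScalarTower k0 A C] [IsScalarTower k0 B C] [IsScalarTower A B C]

theorem mapBaseChange_tower :
    (mapBaseChange k0 A C) ∘ₗ
      (AlgebraTensorModule.cancelBaseChange A B C C (Ω[A⁄k0])).toLinearMap =
    (mapBaseChange k0 B C) ∘ₗ (mapBaseChange k0 A B).baseChange C := by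
  ext x
  simp [mapBaseChange_tmul, ← IsScalarTower.algebraMap_apply]
end

theorem HasIdx.tower (k0 A B C : Type) [CommRing k0] [CommRing A] [CommRing B] [Field C]
    [Algebra k0 A] [Algebra k0 B] [Algebra k0 C] [Algebra A B] [Algebra A C] [Algebra B C]
    [IsScalarTower k0 A B] [IsScalarTower k0 A C] [IsScalarTower k0 B C] [IsScalarTower A B C]
    {m n : ℤ} (h1 : HasIdx ((mapBaseChange k0 A B).baseChange C) m)
    (h2 : HasIdx (mapBaseChange k0 B C) n) : HasIdx (mapBaseChange k0 A C) (m + n) := by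
  have := h2.comp h1
  rw [← mapBaseChange_tower] at this
  exact HasIdx.comp_equiv _ this

theorem HasIdx.of_inj (k0 A B C : Type) [CommRing k0] [CommRing A] [CommRing B] [Field C]
    [Algebra k0 A] [Algebra k0 B] [Algebra A B] [Algebra B C]
    [IsScalarTower k0 A B]
    [Module.Finite B (Ω[B⁄A])]
    (h : Function.Injective ((mapBaseChange k0 A B).baseChange C)) :
    HasIdx ((mapBaseChange k0 A B).baseChange C) (Module.finrank C (C ⊗[B] Ω[B⁄A])) := by
  have := HasIdx.of_exact (F := C) (A := PUnit) (0 : PUnit →ₗ[C] _)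
    ((mapBaseChange k0 A B).baseChange C)
    ((KaehlerDifferential.map k0 A B B).baseChange C)
    (fun _ _ _ => rfl) (by
      intro x; constructor
      · intro hx; exact ⟨0, by simpa using (h (hx.trans (map_zero _).symm)).symm⟩
      · rintro ⟨y, rfl⟩; simp)
    (lTensor_exact C (exact_mapBaseChange_map k0 A B) (map_surjective k0 A B))
    (LinearMap.lTensor_surjective _ (map_surjective k0 A B))
  rw [Module.finrank_zero_of_subsingleton (M := PUnit)] at this
  simpa using this

theorem inj_of_smooth (k0 A B C : Type) [CommRing k0] [CommRing A] [CommRing B] [Field C]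
    [Algebra k0 A] [Algebra k0 B] [Algebra A B] [Algebra B C]
    [IsScalarTower k0 A B] [Algebra.FormallySmooth A B] :
    Function.Injective ((mapBaseChange k0 A B).baseChange C) := by
  have hinj : Function.Injective (mapBaseChange k0 A B) := by
    rw [injective_iff_map_eq_zero]
    intro x hx
    obtain ⟨y, rfl⟩ := (Algebra.H1Cotangent.exact_δ_mapBaseChange k0 A B x).mp hx
    rw [Subsingleton.elim y 0, map_zero]
  obtain ⟨-, l, hl⟩ := ((exact_mapBaseChange_map k0 A B).split_tfae'.out 0 1 :
    (_ ∧ _) ↔ (_ ∧ _)).mp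
    ⟨hinj, Module.projective_lifting_property _ LinearMap.id (map_surjective k0 A B)⟩
  have : (l.baseChange C) ∘ₗ ((mapBaseChange k0 A B).baseChange C) = LinearMap.id := by
    rw [← LinearMap.baseChange_comp, hl, LinearMap.baseChange_id]
  exact Function.LeftInverse.injective (LinearMap.congr_fun this)

theorem HasIdx.of_surj (k0 A B : Type) [CommRing k0] [CommRing A] [Field B]
    [Algebra k0 A] [Algebra k0 B] [Algebra A B] [IsScalarTower k0 A B]
    [Algebra.FormallySmooth k0 B] (hf : Function.Surjective (algebraMap A B))
    (I : Ideal A) (hI : I = RingHom.ker (algebraMap A B))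
    [Module B I.Cotangent] [IsScalarTower A B I.Cotangent] [Module.Finite B I.Cotangent] :
    HasIdx (mapBaseChange k0 A B) (-(Module.finrank B I.Cotangent : ℤ)) := by
  subst hI
  let j := (kerCotangentToTensor k0 A B).extendScalarsOfSurjective hf
  have hj : Function.Injective j := by
    have hs : Function.Surjective (IsScalarTower.toAlgHom k0 A B).kerSquareLift := by
      intro b
      obtain ⟨a, rfl⟩ := hf b
      exact ⟨Ideal.Quotient.mk _ a, rfl⟩
    have hn : IsNilpotent (RingHom.ker
        ((IsScalarTower.toAlgHom k0 A B).kerSquareLift :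
          (A ⧸ RingHom.ker (IsScalarTower.toAlgHom k0 A B).toRingHom ^ 2) →+* B)) := by
      refine ⟨2, ?_⟩
      have := (RingHom.ker (IsScalarTower.toAlgHom k0 A B).toRingHom).cotangentIdeal_square
      rw [← AlgHom.ker_kerSquareLift] at this
      exact this
    obtain ⟨l, hl⟩ := (retractionKerCotangentToTensorEquivSection (R := k0) hf).symm
      ⟨Algebra.FormallySmooth.liftOfSurjective (AlgHom.id k0 B) _ hs hn,
        Algebra.FormallySmooth.comp_liftOfSurjective _ _ _ _⟩
    exact Function.LeftInverse.injective (g := l) (LinearMap.congr_fun hl)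
  have := HasIdx.of_exact (F := B) (B := PUnit) j (mapBaseChange k0 A B) 0 hj
    (exact_kerCotangentToTensor_mapBaseChange k0 A B hf)
    (fun x => by simpa using mapBaseChange_surjective k0 A B hf x) (fun _ => ⟨0, rfl⟩)
  rw [Module.finrank_zero_of_subsingleton (M := PUnit)] at this
  simpa using this

theorem smooth_of_perfect (k0 F : Type) [Field k0] [PerfectField k0] [Field F] [Algebra k0 F] :
    Algebra.FormallySmooth k0 F := by
  rw [Algebra.formallySmooth_iff]
  refine ⟨inferInstance, ?_⟩
  let _ : Algebra (MvPolynomial F k0) F := (MvPolynomial.aeval (R := k0) (id : F → F)).toAlgebra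
  have : IsScalarTower k0 (MvPolynomial F k0) F :=
    IsScalarTower.of_algebraMap_eq' (MvPolynomial.aeval (R := k0) (id : F → F)).comp_algebraMap.symm
  have am (q : MvPolynomial F k0) : algebraMap (MvPolynomial F k0) F q = MvPolynomial.aeval id q :=
    rfl
  have hs : Function.Surjective (algebraMap (MvPolynomial F k0) F) := fun x =>
    ⟨MvPolynomial.X x, by simp [am]⟩
  rw [← Algebra.FormallySmooth.kerCotangentToTensor_injective_iff hs, injective_iff_map_eq_zero]
  intro x hx
  obtain ⟨⟨y, hy⟩, rfl⟩ := Ideal.toCotangent_surjective _ x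
  rw [kerCotangentToTensor_toCotangent] at hx
  have hd (i : F) : MvPolynomial.aeval (R := k0) (id : F → F) (MvPolynomial.pderiv i y) = 0 := by
    have := congrArg (LinearMap.liftBaseChange F (Algebra.linearMap (MvPolynomial F k0) F ∘ₗ
      (mvPolynomialBasis k0 F).coord i)) hx
    simpa [am] using this
  let F0 := IntermediateField.adjoin k0 (y.vars : Set F)
  have : Algebra.EssFiniteType k0 F0 :=
    IntermediateField.essFiniteType_iff.mpr ⟨y.vars, rfl⟩
  have sm : Algebra.FormallySmooth k0 F0 := inferInstance
  obtain ⟨y0, hr⟩ : ∃ y0 : MvPolynomial F0 k0, MvPolynomial.rename (F0.val) y0 = y := by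
    refine MvPolynomial.exists_rename_eq_of_vars_subset_range y _ Subtype.val_injective ?_
    intro z hz
    exact ⟨⟨z, IntermediateField.subset_adjoin _ _ hz⟩, rfl⟩
  let _ : Algebra (MvPolynomial F0 k0) F0 := (MvPolynomial.aeval (R := k0) (id : F0 → F0)).toAlgebra
  have : IsScalarTower k0 (MvPolynomial F0 k0) F0 :=
    IsScalarTower.of_algebraMap_eq'
      (MvPolynomial.aeval (R := k0) (id : F0 → F0)).comp_algebraMap.symm
  have am0 (q : MvPolynomial F0 k0) :
      algebraMap (MvPolynomial F0 k0) F0 q = MvPolynomial.aeval id q := rfl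
  have hs0 : Function.Surjective (algebraMap (MvPolynomial F0 k0) F0) := fun x =>
    ⟨MvPolynomial.X x, by simp [am0]⟩
  have hcomp (q : MvPolynomial F0 k0) :
      MvPolynomial.aeval (R := k0) (id : F → F) (MvPolynomial.rename F0.val q) =
        F0.val (MvPolynomial.aeval id q) := by
    rw [MvPolynomial.aeval_rename, ← AlgHom.comp_apply, MvPolynomial.comp_aeval]
    rfl
  have hvi : Function.Injective F0.val := Subtype.val_injective
  have inj := (Algebra.FormallySmooth.kerCotangentToTensor_injective_iff hs0).mpr
    sm.subsingleton_h1Cotangent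
  rw [injective_iff_map_eq_zero] at inj
  have hy0 : y0 ∈ RingHom.ker (algebraMap (MvPolynomial F0 k0) F0) := by
    rw [RingHom.mem_ker, am, ← hr, hcomp] at hy
    exact hvi (by rw [map_zero]; exact hy)
  have := inj (Ideal.toCotangent _ ⟨y0, hy0⟩) (by
    rw [kerCotangentToTensor_toCotangent]
    apply ((mvPolynomialBasis k0 F0).baseChange F0).repr.injective
    ext i
    have := hd (F0.val i)
    rw [← hr, MvPolynomial.pderiv_rename hvi, hcomp] at this
    have h3 := hvi (this.trans (map_zero _).symm)
    simp [Algebra.smul_def, am0, h3])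
  rw [Ideal.toCotangent_eq_zero] at this ⊢
  have h2 := Ideal.mem_map_of_mem (MvPolynomial.rename (R := k0) F0.val) this
  rw [Ideal.map_pow, hr] at h2
  refine Ideal.pow_right_mono ?_ 2 h2
  rw [Ideal.map_le_iff_le_comap]
  intro q hq
  rw [Ideal.mem_comap, RingHom.mem_ker, am, hcomp]
  rw [RingHom.mem_ker, am0] at hq
  rw [hq, map_zero]

end PartB

section PartC
open TensorProduct IsLocalRing KaehlerDifferential Polynomial

set_option maxHeartbeats 1000000 in
theorem simple_step (k0 F E : Type) [Field k0] [PerfectField k0] [Field F] [Field E]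
    [Algebra k0 F] [Algebra k0 E] [Algebra F E] [IsScalarTower k0 F E]
    (x : E) (hx : IntermediateField.adjoin F {x} = ⊤) :
    ∃ n : ℕ, Algebra.trdeg F E = n ∧ HasIdx (mapBaseChange k0 F E) n := by
  let _ : Algebra F[X] E := (aeval x).toAlgebra
  have am (q : F[X]) : algebraMap F[X] E q = aeval x q := rfl
  have : IsScalarTower F F[X] E :=
    IsScalarTower.of_algebraMap_eq' (aeval (R := F) x).comp_algebraMap.symm
  have : IsScalarTower k0 F[X] E := by
    refine IsScalarTower.of_algebraMap_eq fun r => ?_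
    rw [IsScalarTower.algebraMap_apply k0 F F[X], ← IsScalarTower.algebraMap_apply F F[X] E,
      ← IsScalarTower.algebraMap_apply k0 F E]
  have : Algebra.FormallySmooth k0 E := smooth_of_perfect k0 E
  have : Module.Free F[X] (Ω[F[X]⁄F]) := Module.Free.of_equiv (polynomialEquiv F).symm
  have : Algebra.FormallySmooth F F[X] :=
    .of_equiv (MvPolynomial.uniqueAlgEquiv F PUnit.{1})
  have hO : Module.finrank E (E ⊗[F[X]] Ω[F[X]⁄F]) = 1 := by
    rw [Module.finrank_baseChange, (polynomialEquiv F).finrank_eq, Module.finrank_self]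
  have ha := HasIdx.of_inj k0 F F[X] E (inj_of_smooth k0 F F[X] E)
  rw [hO] at ha
  by_cases hal : IsAlgebraic F x
  · have hadj : Algebra.adjoin F {x} = ⊤ := by
      rw [← IntermediateField.adjoin_simple_toSubalgebra_of_isAlgebraic hal, hx]; rfl
    have hs : Function.Surjective (algebraMap F[X] E) := by
      intro z
      have : z ∈ Algebra.adjoin F {x} := hadj ▸ trivial
      rw [Algebra.adjoin_singleton_eq_range_aeval] at this
      exact this
    refine ⟨0, ?_, ?_⟩
    · rw [Nat.cast_zero, trdeg_eq_zero_iff]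
      have := IntermediateField.isAlgebraic_adjoin_simple (K := F) hal.isIntegral
      rw [hx] at this
      exact (IntermediateField.topEquiv (F := F) (E := E)).isAlgebraic
    · let f := minpoly F x
      have hf0 : f ≠ 0 := minpoly.ne_zero hal.isIntegral
      have hk : Ideal.span {f} = RingHom.ker (algebraMap F[X] E) := by
        ext q
        rw [Ideal.mem_span_singleton, RingHom.mem_ker, am, minpoly.dvd_iff]
      have hfI : f ∈ RingHom.ker (algebraMap F[X] E) := by
        rw [← hk]; exact Ideal.mem_span_singleton_self f
      let e := (RingHom.quotientKerEquivOfSurjective hs)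
      let _ : Module E (RingHom.ker (algebraMap F[X] E)).Cotangent :=
        Module.compHom _ e.symm.toRingHom
      have hsm (q : F[X]) (v : (RingHom.ker (algebraMap F[X] E)).Cotangent) :
          (algebraMap F[X] E q) • v = q • v := by
        have : e.symm (algebraMap F[X] E q) = Ideal.Quotient.mk _ q := by
          rw [RingEquiv.symm_apply_eq]; rfl
        change e.symm (algebraMap F[X] E q) • v = _
        rw [this]; rfl
      have : IsScalarTower F[X] E (RingHom.ker (algebraMap F[X] E)).Cotangent := by
        refine ⟨fun a b v => ?_⟩
        rw [Algebra.smul_def, mul_smul, hsm]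
      have h1 : Module.finrank E (RingHom.ker (algebraMap F[X] E)).Cotangent = 1 := by
        refine finrank_eq_one (Ideal.toCotangent _ ⟨f, hfI⟩) ?_ ?_
        · rw [Ne, Ideal.toCotangent_eq_zero]
          change f ∉ _ ^ 2
          rw [← hk, Ideal.span_singleton_pow,
            Ideal.mem_span_singleton, sq]
          intro hd
          have hd' : f * f ∣ f * 1 := by rwa [mul_one]
          have := (mul_dvd_mul_iff_left hf0).mp hd'
          exact minpoly.not_isUnit F x (isUnit_of_dvd_one this)
        · intro w
          obtain ⟨⟨w, hw⟩, rfl⟩ := Ideal.toCotangent_surjective _ w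
          have hw' := hw
          rw [← hk, Ideal.mem_span_singleton] at hw'
          obtain ⟨q, rfl⟩ := hw'
          refine ⟨algebraMap F[X] E q, ?_⟩
          rw [hsm, ← map_smul]
          congr 1
          ext1
          exact mul_comm _ _
      have : Module.Finite E (RingHom.ker (algebraMap F[X] E)).Cotangent :=
        Module.finite_of_finrank_eq_succ h1
      have hb := HasIdx.of_surj k0 F[X] E hs _ rfl
      rw [h1] at hb
      simpa using HasIdx.tower k0 F F[X] E ha hb
  · have hinj : Function.Injective (algebraMap F[X] E) :=
      transcendental_iff_injective.mp hal
    have : FaithfulSMul F[X] E := (faithfulSMul_iff_algebraMap_injective _ _).mpr hinj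
    have : IsFractionRing F[X] E := by
      refine IsFractionRing.of_field F[X] E fun z => ?_
      have : z ∈ IntermediateField.adjoin F {x} := hx ▸ trivial
      rw [IntermediateField.mem_adjoin_simple_iff] at this
      exact this
    have : Algebra.FormallyEtale F[X] E :=
      Algebra.FormallyEtale.of_isLocalization (nonZeroDivisors F[X])
    refine ⟨1, ?_, ?_⟩
    · have : Algebra.IsAlgebraic F[X] E := IsLocalization.isAlgebraic E (nonZeroDivisors F[X])
      rw [← trdeg_add_eq F F[X] (A := E), trdeg_eq_zero_iff.mpr this]
      simp
    · have hb : HasIdx (mapBaseChange k0 F[X] E) 0 :=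
        HasIdx.of_bijective (tensorKaehlerEquivOfFormallyEtale k0 F[X] E).bijective
      simpa using HasIdx.tower k0 F F[X] E ha hb

set_option maxHeartbeats 1000000 in
theorem cartier (k0 L E : Type) [Field k0] [PerfectField k0] [Field L] [Field E]
    [Algebra k0 L] [Algebra k0 E] [Algebra L E] [IsScalarTower k0 L E]
    (hfg : (⊤ : IntermediateField L E).FG) :
    ∃ n : ℕ, Algebra.trdeg L E = n ∧ HasIdx (mapBaseChange k0 L E) n := by
  have hM : ∀ M : IntermediateField L E, IsScalarTower k0 M E := fun M =>
    IsScalarTower.of_algebraMap_eq fun r => by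
      rw [IsScalarTower.algebraMap_apply k0 L M, ← IsScalarTower.algebraMap_apply L M E,
        ← IsScalarTower.algebraMap_apply k0 L E]
  have key : ∃ n : ℕ, Algebra.trdeg L (⊤ : IntermediateField L E) = n ∧
      HasIdx (mapBaseChange k0 L (⊤ : IntermediateField L E)) n := by
    refine IntermediateField.induction_on_adjoin_fg (fun M => ∃ n : ℕ, Algebra.trdeg L M = n ∧
      HasIdx (mapBaseChange k0 L M) n) ?_ ?_ _ hfg
    · refine simple_step k0 L (⊥ : IntermediateField L E) 0 ?_
      rw [eq_top_iff]
      rintro ⟨y, hy⟩ -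
      obtain ⟨z, rfl⟩ := IntermediateField.mem_bot.mp hy
      exact IntermediateField.algebraMap_mem _ z
    · rintro M x ⟨m, hm, hm'⟩
      obtain ⟨n, hn, hn'⟩ := simple_step k0 M (IntermediateField.adjoin M {x})
        (IntermediateField.AdjoinSimple.gen M x) (by
          apply IntermediateField.lift_injective
          rw [IntermediateField.lift_adjoin_simple, IntermediateField.lift_top]
          rfl)
      have : FaithfulSMul M (IntermediateField.adjoin M {x}) :=
        (faithfulSMul_iff_algebraMap_injective _ _).mpr (RingHom.injective _)
      have : IsScalarTower k0 L (IntermediateField.adjoin M {x}) :=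
        IsScalarTower.of_algebraMap_eq fun r => by
          rw [IsScalarTower.algebraMap_apply L M (IntermediateField.adjoin M {x}),
            IsScalarTower.algebraMap_apply k0 M (IntermediateField.adjoin M {x}),
            ← IsScalarTower.algebraMap_apply k0 L M]
      refine ⟨m + n, ?_, ?_⟩
      · rw [Nat.cast_add, ← hm, ← hn]
        exact (trdeg_add_eq L M (A := IntermediateField.adjoin M {x})).symm
      · rw [Nat.cast_add]
        exact HasIdx.tower k0 L M (IntermediateField.adjoin M {x}) hm'.baseChange hn'
  obtain ⟨m, hm, hm'⟩ := key
  obtain ⟨n, hn, hn'⟩ := simple_step k0 (⊤ : IntermediateField L E) E 0 (by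
    rw [eq_top_iff]
    intro y _
    exact IntermediateField.algebraMap_mem _ (⟨y, trivial⟩ : (⊤ : IntermediateField L E)))
  refine ⟨m + n, ?_, ?_⟩
  · rw [Nat.cast_add, ← hm, ← hn]
    exact (trdeg_add_eq L (⊤ : IntermediateField L E) (A := E)).symm
  · rw [Nat.cast_add]
    exact HasIdx.tower k0 L (⊤ : IntermediateField L E) E hm'.baseChange hn'

end PartC

section PartD
open TensorProduct IsLocalRing KaehlerDifferential

theorem inj_pushout (k0 k K L R C : Type) [CommRing k0] [CommRing k] [CommRing K] [CommRing L]
    [CommRing R] [Field C] [Algebra k0 k] [Algebra k0 L] [Algebra k0 K] [Algebra k0 R]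
    [Algebra k K] [Algebra k L] [Algebra k R] [Algebra K R] [Algebra L R] [Algebra R C]
    [IsScalarTower k0 k L] [IsScalarTower k0 K R] [IsScalarTower k0 L R]
    [IsScalarTower k K R] [IsScalarTower k L R]
    [Algebra.IsPushout k K L R]
    (hL : ∀ a : k, D k0 L (algebraMap k L a) = 0) :
    Function.Injective ((mapBaseChange k0 L R).baseChange C) := by
  let d : Derivation k L (Ω[L⁄k0]) := Derivation.mk'
    { toFun := D k0 L
      map_add' := map_add _
      map_smul' := fun a x => by
        simp only [Algebra.smul_def, Derivation.leibniz, hL, smul_zero, add_zero,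
          RingHom.id_apply, algebraMap_smul] }
    (fun a b => (D k0 L).leibniz a b)
  let l : Ω[R⁄k0] →ₗ[R] R ⊗[L] Ω[L⁄k0] :=
    (d.liftKaehlerDifferential.baseChange R) ∘ₗ
      (tensorKaehlerEquiv k K L R).symm.toLinearMap ∘ₗ (map k0 K R R)
  have hl : l ∘ₗ mapBaseChange k0 L R = LinearMap.id := by
    ext x
    have hx : (tensorKaehlerEquiv k K L R).symm (D K R (algebraMap L R x)) = 1 ⊗ₜ D k L x := by
      rw [LinearEquiv.symm_apply_eq, tensorKaehlerEquiv_tmul_D, one_smul]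
    simp [l, hx]
    rfl
  have : (l.baseChange C) ∘ₗ ((mapBaseChange k0 L R).baseChange C) = LinearMap.id := by
    rw [← LinearMap.baseChange_comp, hl, LinearMap.baseChange_id]
  exact Function.LeftInverse.injective (LinearMap.congr_fun this)

set_option maxHeartbeats 1000000 in
theorem core (k0 k K L R : Type) [Field k0] [PerfectField k0] [Field k] [Field K] [Field L]
    [CommRing R] [IsLocalRing R] [Algebra k0 k] [Algebra k0 L] [Algebra k0 K] [Algebra k0 R]
    [Algebra k K] [Algebra k L] [Algebra k R] [Algebra K R] [Algebra L R]
    [IsScalarTower k0 k L] [IsScalarTower k0 K R] [IsScalarTower k0 L R]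
    [IsScalarTower k K R] [IsScalarTower k L R]
    [Algebra.IsPushout k K L R] [Algebra.IsAlgebraic k L]
    (hL : ∀ a : k, D k0 L (algebraMap k L a) = 0)
    (hfg : (⊤ : IntermediateField k K).FG) :
    ∃ t : ℕ, Algebra.trdeg k K = t ∧
      Module.finrank (ResidueField R) (CotangentSpace R) + t = Module.finrank K (Ω[K⁄k]) := by
  have hp : Algebra.IsPushout k L K R := Algebra.IsPushout.symm inferInstance
  have : Algebra.EssFiniteType k K := by
    have := IntermediateField.essFiniteType_iff.mpr hfg
    exact Algebra.EssFiniteType.of_surjective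
      (IntermediateField.topEquiv (F := k) (E := K)).toAlgHom
      (IntermediateField.topEquiv (F := k) (E := K)).surjective
  have : Algebra.EssFiniteType L R :=
    Algebra.EssFiniteType.of_surjective (Algebra.IsPushout.equiv k L K R).toAlgHom
      (Algebra.IsPushout.equiv k L K R).surjective
  have : IsNoetherianRing R := Algebra.EssFiniteType.isNoetherianRing L R
  have hs : Function.Surjective (algebraMap R (ResidueField R)) := residue_surjective
  have : Algebra.EssFiniteType L (ResidueField R) :=
    Algebra.EssFiniteType.of_surjective (IsScalarTower.toAlgHom L R (ResidueField R)) hs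
  obtain ⟨n, hn, hn'⟩ := cartier k0 L (ResidueField R) (IntermediateField.fg_top _ _)
  have : Algebra.FormallySmooth k0 (ResidueField R) := smooth_of_perfect _ _
  have ha := HasIdx.of_inj k0 L R (ResidueField R) (inj_pushout k0 k K L R (ResidueField R) hL)
  have : Module.Finite (ResidueField R) (maximalIdeal R).Cotangent :=
    inferInstanceAs (Module.Finite (ResidueField R) (CotangentSpace R))
  have : IsScalarTower R (ResidueField R) (maximalIdeal R).Cotangent :=
    inferInstanceAs (IsScalarTower R (ResidueField R) (CotangentSpace R))
  have hb := HasIdx.of_surj k0 R (ResidueField R) hs (maximalIdeal R) ker_residue.symm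
  have hc := (HasIdx.tower k0 L R (ResidueField R) ha hb).unique hn'
  have hO : Module.finrank (ResidueField R) (ResidueField R ⊗[R] Ω[R⁄L]) =
      Module.finrank K (Ω[K⁄k]) := by
    rw [← ((tensorKaehlerEquiv k L K R).baseChange R (ResidueField R) _ _).finrank_eq,
      (AlgebraTensorModule.cancelBaseChange K R (ResidueField R) (ResidueField R)
        (Ω[K⁄k])).finrank_eq, Module.finrank_baseChange]
  have hint : Algebra.IsIntegral k L := inferInstance
  have : Algebra.IsIntegral K R := Algebra.IsPushout.isIntegral' k K L R
  have : Algebra.IsIntegral K (ResidueField R) := by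
    refine ⟨fun x => ?_⟩
    obtain ⟨y, rfl⟩ := hs x
    exact (Algebra.IsIntegral.isIntegral (R := K) y).algebraMap
  have h1 := trdeg_add_eq k K (A := ResidueField R)
  have h2 := trdeg_add_eq k L (A := ResidueField R)
  have h3 : Algebra.trdeg K (ResidueField R) = 0 := trdeg_eq_zero_iff.mpr inferInstance
  have h4 : Algebra.trdeg k L = 0 := trdeg_eq_zero_iff.mpr inferInstance
  rw [h3, add_zero] at h1
  rw [h4, zero_add, ← h1] at h2
  refine ⟨n, h2 ▸ hn, ?_⟩
  rw [hO] at hc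
  change _ + -(Module.finrank (ResidueField R) (CotangentSpace R) : ℤ) = _ at hc
  omega

end PartD

attribute [local instance] Algebra.TensorProduct.rightAlgebra in
theorem core' (p : ℕ) [Fact p.Prime] (k K L : Type) [Field k] [Field K] [Field L] [CharP k p]
    [Algebra k K] [Algebra k L] [IsLocalRing (K ⊗[k] L)] [Algebra.IsAlgebraic k L]
    (hroot : ∀ a : k, ∃ b : L, b ^ p = algebraMap k L a)
    (hfg : (⊤ : IntermediateField k K).FG) :
    ∃ t : ℕ, Algebra.trdeg k K = t ∧
      edim (K ⊗[k] L) + t = Module.finrank K (Ω[K⁄k]) := by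
  let _ : Algebra (ZMod p) k := ZMod.algebra k p
  let _ : Algebra (ZMod p) K := ((algebraMap k K).comp (algebraMap (ZMod p) k)).toAlgebra
  let _ : Algebra (ZMod p) L := ((algebraMap k L).comp (algebraMap (ZMod p) k)).toAlgebra
  have : IsScalarTower (ZMod p) k K := .of_algebraMap_eq' rfl
  have : IsScalarTower (ZMod p) k L := .of_algebraMap_eq' rfl
  have : IsScalarTower (ZMod p) K (K ⊗[k] L) := inferInstance
  have : IsScalarTower (ZMod p) L (K ⊗[k] L) := .of_algebraMap_eq' (Subsingleton.elim _ _)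
  have hL : ∀ a : k, KaehlerDifferential.D (ZMod p) L (algebraMap k L a) = 0 := by
    intro a
    obtain ⟨b, hb⟩ := hroot a
    have : CharP L p := charP_of_injective_algebraMap (algebraMap k L).injective p
    rw [← hb, Derivation.leibniz_pow, ← Nat.cast_smul_eq_nsmul L, CharP.cast_eq_zero, zero_smul]
  exact core (ZMod p) k K L (K ⊗[k] L) hL hfg

/-- **Proposition 3.2, Schröer.** For a finitely generated field extension `K/k`
of characteristic `p > 0`, `edim (K ⊗_k k^{1/p}) + trdeg(K/k) = pdeg(K/k)`; moreover for any
purely inseparable intermediate extension `k'` with `k^{1/p} ⊆ k' ⊆ Ω`,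
`edim (K ⊗_k k') = edim (K ⊗_k k^{1/p})`. -/
theorem edim_tensor_pth_roots_add_trdeg_eq_pdeg
    (p : ℕ) [Fact p.Prime]
    (k K Ω : Type) [Field k] [Field K] [Field Ω] [CharP k p]
    [Algebra k K] [Algebra K Ω] [Algebra k Ω] [IsScalarTower k K Ω] [IsAlgClosure K Ω]
    (hfg : (⊤ : IntermediateField k K).FG)
    (kp : IntermediateField k Ω)
    (hkp : ∀ x : Ω, x ∈ kp ↔ x ^ p ∈ Set.range (algebraMap k Ω))
    [IsLocalRing (K ⊗[k] kp)] :
    (∀ (ι : Type) (b : ι → K), IsTranscendenceBasis k b →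
      (edim (K ⊗[k] kp) : Cardinal) + Cardinal.mk ι = Module.rank K (Ω[K⁄k])) ∧
    (∀ k' : IntermediateField k Ω, kp ≤ k' → IsPurelyInseparable k k' →
      ∀ [IsLocalRing (K ⊗[k] k')], edim (K ⊗[k] k') = edim (K ⊗[k] kp)) := by
  have hp : p.Prime := Fact.out
  have hac : IsAlgClosed Ω := IsAlgClosure.isAlgClosed K
  have hroot : ∀ k' : IntermediateField k Ω, kp ≤ k' → ∀ a : k, ∃ b : k',
      b ^ p = algebraMap k k' a := by
    intro k' hk' a
    obtain ⟨z, hz⟩ := IsAlgClosed.exists_pow_nat_eq (algebraMap k Ω a) hp.pos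
    exact ⟨⟨z, hk' ((hkp z).mpr ⟨a, hz.symm⟩)⟩, Subtype.ext hz⟩
  have halg : Algebra.IsAlgebraic k kp := by
    have : Algebra.IsIntegral k kp := by
      refine ⟨fun x => ?_⟩
      obtain ⟨a, ha⟩ := (hkp x).mp x.2
      have hx : x ^ p = algebraMap k kp a := Subtype.ext ha.symm
      exact IsIntegral.of_pow hp.pos (hx ▸ isIntegral_algebraMap)
    infer_instance
  obtain ⟨t, ht, h⟩ := core' p k K kp (hroot kp le_rfl) hfg
  refine ⟨fun ι b hb => ?_, fun k' hk' hpi _ => ?_⟩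
  · have : Algebra.EssFiniteType k K := by
      have := IntermediateField.essFiniteType_iff.mpr hfg
      exact Algebra.EssFiniteType.of_surjective
        (IntermediateField.topEquiv (F := k) (E := K)).toAlgHom
        (IntermediateField.topEquiv (F := k) (E := K)).surjective
    have : Module.Finite K (Ω[K⁄k]) := inferInstance
    rw [hb.cardinalMk_eq_trdeg, ht, ← Module.finrank_eq_rank, ← h, Nat.cast_add]
  · have : Algebra.IsAlgebraic k k' := IsPurelyInseparable.isAlgebraic k k'
    obtain ⟨t', ht', h'⟩ := core' p k K k' (hroot k' hk') hfg
    have : t' = t := by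
      rw [ht] at ht'
      exact_mod_cast ht'.symm
    omega
end

section
/- Let k be a field of characteristic p > 0, let R be a local Noetherian k-algebra, and let k'/k be a purely inseparable field extension such that R ⊗_k k' is Noetherian. Then there exists a finite subextension k ⊆ k'' ⊆ k' such that edim(R ⊗_k k'') = edim(R ⊗_k k'); that is, the embedding jump ejump_{k'/k}(R) is already attained over some finite subextension of k'/k. -/
open TensorProduct IsLocalRing

theorem edim_eq_of_retraction (A B : Type) [CommRing A] [CommRing B] [IsLocalRing A]
    [IsLocalRing B] (φ : A →+* B) (ρ : B →+ A) (h : ∀ a b, ρ (φ a * b) = a * ρ b)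
    (h1 : ρ 1 = 1) (t : Finset B) (ht : Ideal.span (t : Set B) = maximalIdeal B)
    (hc : t.card = (maximalIdeal B).spanFinrank) (hr : (t : Set B) ⊆ Set.range φ) :
    edim A = edim B := by
  classical
  have hmap : ∀ (I : Ideal A) (y : B), y ∈ I.map φ → ρ y ∈ I := by
    intro I y hy
    suffices H : ∀ b, ρ (b * y) ∈ I by simpa using H 1
    induction hy using Submodule.span_induction with
    | mem x hx =>
      obtain ⟨a, ha, rfl⟩ := hx
      intro b
      rw [mul_comm, h]
      exact I.mul_mem_right _ ha
    | zero => simp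
    | add x y _ _ hx hy =>
      intro b
      rw [mul_add, map_add]
      exact I.add_mem (hx b) (hy b)
    | smul c x _ hx =>
      intro b
      rw [smul_eq_mul, ← mul_assoc]
      exact hx _
  have hφ : ∀ a, ρ (φ a) = a := fun a => by simpa [h1] using h a 1
  have hlt : (maximalIdeal A).map φ ≤ maximalIdeal B := by
    apply IsLocalRing.le_maximalIdeal
    intro hT
    have : ρ 1 ∈ maximalIdeal A := hmap _ _ (hT ▸ Submodule.mem_top)
    rw [h1] at this
    exact (Ideal.ne_top_iff_one _).1 (maximalIdeal.isMaximal A).ne_top this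
  have hcomap : (maximalIdeal B).comap φ = maximalIdeal A :=
    ((maximalIdeal.isMaximal A).eq_of_le (Ideal.comap_ne_top _
      (maximalIdeal.isMaximal B).ne_top) (Ideal.map_le_iff_le_comap.1 hlt)).symm
  obtain ⟨s, hs, hcard⟩ : ∃ s : Finset A, φ '' s = t ∧ s.card ≤ t.card := by
    have hr' : ∀ x, x ∈ t → ∃ a, φ a = x := fun x hx => hr hx
    choose! g hg using hr'
    refine ⟨t.image g, ?_, Finset.card_image_le⟩
    ext x
    simp only [Finset.coe_image, Set.mem_image, Finset.mem_coe]
    constructor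
    · rintro ⟨_, ⟨y, hy, rfl⟩, rfl⟩
      rwa [hg y hy]
    · intro hx
      exact ⟨g x, ⟨x, hx, rfl⟩, hg x hx⟩
  have hsm : (Ideal.span (s : Set A)).map φ = maximalIdeal B := by
    rw [Ideal.map_span, hs, ht]
  have hA : Ideal.span (s : Set A) = maximalIdeal A := by
    apply le_antisymm
    · rw [← hcomap, ← Ideal.map_le_iff_le_comap, hsm]
    · intro a ha
      have := hmap (Ideal.span (s : Set A)) (φ a) (hsm ▸ hlt (Ideal.mem_map_of_mem φ ha))
      rwa [hφ] at this
  have fgA : (maximalIdeal A).FG := ⟨s, hA⟩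
  have fgB : (maximalIdeal B).FG := ⟨t, ht⟩
  unfold edim
  rw [← spanFinrank_maximalIdeal_eq_finrank_cotangentSpace_of_fg fgA,
    ← spanFinrank_maximalIdeal_eq_finrank_cotangentSpace_of_fg fgB]
  apply le_antisymm
  · rw [← hc]
    refine le_trans ?_ hcard
    have := Submodule.spanFinrank_span_le_ncard_of_finite (R := A) s.finite_toSet
    rw [Set.ncard_coe_finset] at this
    rw [← hA]
    exact this
  · have := Ideal.spanFinrank_map_le_of_fg φ fgA
    rwa [← hA, hsm, hA] at this

/-- For a purely inseparable extension `k'/k` and a Noetherian local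
`k`-algebra `R` with `R ⊗_k k'` Noetherian, the embedding jump is attained over some finite
subextension `k ⊆ k'' ⊆ k'`: there is a finite subextension with
`edim (R ⊗_k k'') = edim (R ⊗_k k')`. -/
theorem exists_finiteDimensional_subextension_edim_eq
    (p : ℕ) [Fact p.Prime]
    (k k' : Type) [Field k] [Field k'] [CharP k p] [Algebra k k'] [IsPurelyInseparable k k']
    (R : Type) [CommRing R] [IsLocalRing R] [IsNoetherianRing R] [Algebra k R]
    [IsLocalRing (R ⊗[k] k')] [IsNoetherianRing (R ⊗[k] k')] :
    ∃ k'' : IntermediateField k k', FiniteDimensional k k'' ∧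
      ∀ [IsLocalRing (R ⊗[k] ↥k'')], edim (R ⊗[k] ↥k'') = edim (R ⊗[k] k') := by
  have fg : (maximalIdeal (R ⊗[k] k')).FG := (maximalIdeal _).fg_of_isNoetherianRing
  obtain ⟨t, hc, ht⟩ := Submodule.FG.exists_span_finset_card_eq_spanFinrank fg
  obtain ⟨N, hN, hle⟩ :=
    TensorProduct.exists_finite_submodule_right_of_setFinite (t : Set (R ⊗[k] k')) t.finite_toSet
  obtain ⟨u, hu⟩ := Module.Finite.iff_fg.1 hN
  let K : IntermediateField k k' := IntermediateField.adjoin k (u : Set k')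
  have hNK : N ≤ Subalgebra.toSubmodule K.toSubalgebra := by
    rw [← hu, Submodule.span_le]
    exact IntermediateField.subset_adjoin k _
  have hfin : FiniteDimensional k K :=
    IntermediateField.finiteDimensional_adjoin
      (fun x _ => (Algebra.IsAlgebraic.isAlgebraic (R := k) x).isIntegral)
  refine ⟨K, hfin, ?_⟩
  intro _
  obtain ⟨π, hπ⟩ := (Algebra.linearMap K k').exists_leftInverse_of_injective
    (LinearMap.ker_eq_bot.2 (algebraMap K k').injective)
  have hπ1 : π 1 = 1 := by simpa using LinearMap.congr_fun hπ 1
  let φ : R ⊗[k] K →ₐ[k] R ⊗[k] k' := Algebra.TensorProduct.map (AlgHom.id k R) K.val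
  let ρ : R ⊗[k] k' →ₗ[k] R ⊗[k] K := LinearMap.lTensor R (π.restrictScalars k)
  refine edim_eq_of_retraction _ _ φ.toRingHom ρ.toAddMonoidHom ?_ ?_ t ht hc ?_
  · intro a b
    change ρ (φ a * b) = a * ρ b
    induction a with
    | zero => simp
    | add x y hx hy => simp only [map_add, add_mul, hx, hy]
    | tmul r x =>
      induction b with
      | zero => simp
      | add x y hx hy => simp only [map_add, mul_add, hx, hy]
      | tmul r' y =>
        have : π ((x : k') * y) = x * π y := by
          simpa [Algebra.smul_def] using π.map_smul x y
        simp [φ, ρ, this]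
  · change ρ 1 = 1
    simp [ρ, Algebra.TensorProduct.one_def, hπ1]
  · intro x hx
    obtain ⟨y, hy⟩ := hle hx
    refine ⟨LinearMap.lTensor R (Submodule.inclusion hNK) y, ?_⟩
    rw [← hy]
    clear hy
    change φ _ = _
    induction y with
    | zero => simp
    | add x y hx hy =>
      rw [map_add, map_add, map_add]
      exact congrArg₂ _ hx hy
    | tmul r n => rfl
end

section
/- Let k be an imperfect field of characteristic p > 0 with algebraic closure Ω, let t ∈ k \ k^p, and set k_1 := k(t^{1/p}) ⊆ Ω. Let R be a Noetherian local k-algebra with maximal ideal m and residue field K := R/m, and let R_1 := R ⊗_k k_1, a Noetherian local ring with maximal ideal m_1 and residue field K_1. Then the following are equivalent: (i) [K_1 : K] = p; (ii) K ⊗_k k_1 is a field (equal to K_1); (iii) m_1 = m·R_1. Consequently, if any of these hold, then edim(R ⊗_k k_1) = edim(R), i.e., ejump_{k_1/k}(R) = 0. -/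
open TensorProduct IsLocalRing IntermediateField

theorem aux_edim (R S : Type) [CommRing R] [CommRing S] [IsLocalRing R] [IsLocalRing S]
    [Algebra R S] [IsLocalHom (algebraMap R S)] [Module.Flat R S]
    (h : maximalIdeal S = (maximalIdeal R).map (algebraMap R S)) :
    edim S = edim R := by
  let f : S ⊗[R] R ≃ₐ[S] S := Algebra.TensorProduct.rid R S S
  let I := maximalIdeal R
  let J : Ideal (S ⊗[R] R) :=
    I.map (Algebra.TensorProduct.includeRight.toRingHom : R →+* S ⊗[R] R)
  have hJ : maximalIdeal S = J.map (f : S ⊗[R] R →+* S) := by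
    rw [h, Ideal.map_map]
    congr 1
    ext r
    simp [f, Algebra.smul_def]
  have hJ1 : J ≤ (maximalIdeal S).comap f.toAlgHom := by
    intro y hy
    rw [hJ]
    exact Ideal.mem_map_of_mem (f : S ⊗[R] R →+* S) hy
  have hJ2 : maximalIdeal S ≤ J.comap f.symm.toAlgHom := by
    rw [hJ, Ideal.map_le_iff_le_comap]
    intro y hy
    simp only [Ideal.mem_comap]
    convert hy
    exact f.symm_apply_apply y
  let e1 : J.Cotangent ≃ₗ[S] CotangentSpace S :=
    LinearEquiv.ofLinearMap (Ideal.mapCotangent J (maximalIdeal S) f.toAlgHom hJ1)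
      (Ideal.mapCotangent (maximalIdeal S) J f.symm.toAlgHom hJ2)
      (by
        ext y
        obtain ⟨y, rfl⟩ := Ideal.toCotangent_surjective _ y
        exact congrArg (Ideal.toCotangent (maximalIdeal S)) (Subtype.ext (f.apply_symm_apply (y : S))))
      (by
        ext y
        obtain ⟨y, rfl⟩ := Ideal.toCotangent_surjective _ y
        exact congrArg (Ideal.toCotangent J) (Subtype.ext (f.symm_apply_apply (y : S ⊗[R] R))))
  let e : S ⊗[R] CotangentSpace R ≃ₗ[S] CotangentSpace S :=
    (I.tensorCotangentEquiv R S).trans e1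
  let K := ResidueField R
  let L := ResidueField S
  have : TensorProduct.CompatibleSMul R K K (CotangentSpace R) :=
    .of_algebraMap_surjective _ _ residue_surjective
  have : TensorProduct.CompatibleSMul S L L (CotangentSpace S) :=
    .of_algebraMap_surjective _ _ residue_surjective
  let a : K ⊗[R] CotangentSpace R ≃ₗ[K] CotangentSpace R :=
    TensorProduct.lidOfCompatibleSMul R K _
  let b : L ⊗[S] CotangentSpace S ≃ₗ[L] CotangentSpace S :=
    TensorProduct.lidOfCompatibleSMul S L _
  let c : L ⊗[S] (S ⊗[R] CotangentSpace R) ≃ₗ[L] L ⊗[S] CotangentSpace S :=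
    LinearEquiv.baseChange S L _ _ e
  let d : L ⊗[S] (S ⊗[R] CotangentSpace R) ≃ₗ[L] L ⊗[R] CotangentSpace R :=
    AlgebraTensorModule.cancelBaseChange R S L L _
  let d' : L ⊗[K] (K ⊗[R] CotangentSpace R) ≃ₗ[L] L ⊗[R] CotangentSpace R :=
    AlgebraTensorModule.cancelBaseChange R K L L _
  unfold edim
  rw [← (d'.trans (d.symm.trans (c.trans b))).finrank_eq, Module.finrank_baseChange,
    a.finrank_eq]

theorem aux_tfae (k R A : Type) [Field k] [CommRing R] [IsLocalRing R] [Algebra k R]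
    [Field A] [Algebra k A] [FiniteDimensional k A] [IsLocalRing (R ⊗[k] A)]
    [IsLocalHom (algebraMap R (R ⊗[k] A))] :
    (Module.finrank (ResidueField R) (ResidueField (R ⊗[k] A)) = Module.finrank k A ↔
      IsField (ResidueField R ⊗[k] A)) ∧
    (IsField (ResidueField R ⊗[k] A) ↔
      maximalIdeal (R ⊗[k] A) = (maximalIdeal R).map (algebraMap R (R ⊗[k] A))) := by
  let K := ResidueField R
  let L := ResidueField (R ⊗[k] A)
  let g : A →ₐ[k] L := (IsScalarTower.toAlgHom k (R ⊗[k] A) L).comp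
    Algebra.TensorProduct.includeRight
  let φ : K ⊗[k] A →ₐ[K] L :=
    Algebra.TensorProduct.lift (Algebra.ofId K L) g (fun _ _ => Commute.all _ _)
  let r : R →ₐ[k] K := IsScalarTower.toAlgHom k R K
  let ψ : R ⊗[k] A →ₐ[k] K ⊗[k] A := Algebra.TensorProduct.map r (AlgHom.id k A)
  have hr : Function.Surjective r := residue_surjective
  have hψ : Function.Surjective ψ :=
    TensorProduct.map_surjective hr Function.surjective_id
  have hφψ : ∀ y, φ (ψ y) = residue (R ⊗[k] A) y := by
    intro y
    induction y with
    | zero => simp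
    | add u v hu hv => simp [hu, hv]
    | tmul u v =>
      have h1 : φ (ψ (u ⊗ₜ v)) = residue (R ⊗[k] A) (u ⊗ₜ 1) * residue (R ⊗[k] A) (1 ⊗ₜ v) := rfl
      rw [h1, ← map_mul]
      simp
  have hφ : Function.Surjective φ := by
    intro y
    obtain ⟨y, rfl⟩ := residue_surjective y
    exact ⟨ψ y, hφψ y⟩
  have hkerψ : RingHom.ker ψ = (maximalIdeal R).map (algebraMap R (R ⊗[k] A)) := by
    have := Algebra.TensorProduct.rTensor_ker (R := k) (C := A) r hr
    have h2 : RingHom.ker r = maximalIdeal R := ker_residue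
    rw [h2] at this
    exact this
  have hinj3 : Function.Injective φ ↔
      maximalIdeal (R ⊗[k] A) = (maximalIdeal R).map (algebraMap R (R ⊗[k] A)) := by
    rw [← hkerψ]
    constructor
    · intro h
      ext y
      rw [← residue_eq_zero_iff, ← hφψ, RingHom.mem_ker]
      exact map_eq_zero_iff φ h
    · intro h
      rw [injective_iff_map_eq_zero]
      intro y hy
      obtain ⟨y, rfl⟩ := hψ y
      rw [hφψ, residue_eq_zero_iff, h] at hy
      exact hy
  have hinj2 : Function.Injective φ ↔ IsField (K ⊗[k] A) := by
    constructor
    · intro h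
      exact (RingEquiv.ofBijective φ ⟨h, hφ⟩).toMulEquiv.isField (Field.toIsField L)
    · intro h
      let := h.toField
      exact RingHom.injective (φ : K ⊗[k] A →+* L)
  have hfr : Module.finrank K (K ⊗[k] A) = Module.finrank k A := Module.finrank_baseChange
  have hinj1 : Function.Injective φ ↔ Module.finrank K L = Module.finrank k A := by
    constructor
    · intro h
      rw [← hfr]
      exact ((LinearEquiv.ofBijective φ.toLinearMap ⟨h, hφ⟩).finrank_eq).symm
    · intro h
      have : FiniteDimensional K L := Module.Finite.of_surjective φ.toLinearMap hφ
      exact (LinearMap.injective_iff_surjective_of_finrank_eq_finrank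
        (f := φ.toLinearMap) (hfr.trans h.symm)).2 hφ
  exact ⟨hinj1.symm.trans hinj2, hinj2.symm.trans hinj3⟩

/-- Let `k₁ = k(t^{1/p})` for `t ∈ k \ kᵖ`, let `R` be a Noetherian local
`k`-algebra with residue field `K`, and let `R₁ := R ⊗_k k₁` with maximal ideal `m₁` and residue
field `K₁`.  The following are equivalent: (i) `[K₁ : K] = p`; (ii) `K ⊗_k k₁` is a field;
(iii) `m₁ = m·R₁`.  Moreover, if they hold then `edim R₁ = edim R`. -/
theorem edim_tensor_eq_tfae_of_degree_p
    (p : ℕ) [Fact p.Prime]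
    (k Ω : Type) [Field k] [Field Ω] [CharP k p] [Algebra k Ω] [IsAlgClosure k Ω]
    (t : k) (ht : ∀ c : k, c ^ p ≠ t)
    (x : Ω) (hx : x ^ p = algebraMap k Ω t)
    (R : Type) [CommRing R] [IsLocalRing R] [IsNoetherianRing R] [Algebra k R]
    [IsLocalRing (R ⊗[k] (adjoin k {x} : IntermediateField k Ω))]
    [IsLocalHom (@algebraMap R (R ⊗[k] (adjoin k {x} : IntermediateField k Ω)) _ Algebra.TensorProduct.instSemiring _)] :
    ((Module.finrank (ResidueField R)
        (ResidueField (R ⊗[k] (adjoin k {x} : IntermediateField k Ω))) = p) ↔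
      IsField ((ResidueField R) ⊗[k] (adjoin k {x} : IntermediateField k Ω))) ∧
    (IsField ((ResidueField R) ⊗[k] (adjoin k {x} : IntermediateField k Ω)) ↔
      maximalIdeal (R ⊗[k] (adjoin k {x} : IntermediateField k Ω)) =
        (maximalIdeal R).map
          (@algebraMap R (R ⊗[k] (adjoin k {x} : IntermediateField k Ω)) _ Algebra.TensorProduct.instSemiring _)) ∧
    (maximalIdeal (R ⊗[k] (adjoin k {x} : IntermediateField k Ω)) =
        (maximalIdeal R).map
          (@algebraMap R (R ⊗[k] (adjoin k {x} : IntermediateField k Ω)) _ Algebra.TensorProduct.instSemiring _) →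
      edim (R ⊗[k] (adjoin k {x} : IntermediateField k Ω)) = edim R) := by
  have hp : p.Prime := Fact.out
  have hirr : Irreducible (Polynomial.X ^ p - Polynomial.C t) :=
    X_pow_sub_C_irreducible_of_prime hp ht
  have hmp : Polynomial.X ^ p - Polynomial.C t = minpoly k x :=
    minpoly.eq_of_irreducible_of_monic hirr (by simp [hx])
      (Polynomial.monic_X_pow_sub_C t hp.ne_zero)
  have hint : IsIntegral k x :=
    ⟨_, Polynomial.monic_X_pow_sub_C t hp.ne_zero, by simp [hx]⟩
  have hfd : FiniteDimensional k (adjoin k {x} : IntermediateField k Ω) :=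
    adjoin.finiteDimensional hint
  have hdeg : Module.finrank k (adjoin k {x} : IntermediateField k Ω) = p := by
    rw [adjoin.finrank hint, ← hmp, Polynomial.natDegree_X_pow_sub_C]
  have H := aux_tfae k R (adjoin k {x} : IntermediateField k Ω)
  rw [hdeg] at H
  exact ⟨H.1, H.2, fun h => aux_edim R _ h⟩
end
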